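/- For every pair of positive integers (m,n) with n ≥ 2, there exists a constant c₀ ∈ (0,1), depending only on m and n, such that for every 0 < c < c₀ there exists a nonempty connected open set D ⊆ ℝⁿ with the following properties: (a) for every multi-index α ∈ ℕⁿ with |α| ≤ m, ∫_D e^{2⟨α+𝟏,x⟩} dx = c · (1/(2π)ⁿ) · α!(m−|α|)!/m!; (b) for every multi-index α ∈ ℕⁿ with |α| ≥ m+1, ∫_D e^{2⟨α+𝟏,x⟩} dx = +∞. -/

import Mathlib

open MeasureTheory Real

/-- The exponents `α ∈ ℕⁿ` with `|α| ≤ m`. -/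
def boundedExponents (n m : ℕ) : Finset (Fin n → ℕ) :=
  (Fintype.piFinset fun _ => Finset.range (m + 1)).filter fun α => ∑ j, α j ≤ m

theorem mem_boundedExponents {n m : ℕ} {α : Fin n → ℕ} :
    α ∈ boundedExponents n m ↔ ∑ j, α j ≤ m := by
  simp only [boundedExponents, Finset.mem_filter, Fintype.mem_piFinset, Finset.mem_range,
    and_iff_right_iff_imp]
  intro h j
  have := Finset.single_le_sum (f := α) (fun _ _ => Nat.zero_le _) (Finset.mem_univ j)
  omega

/-- The function `x ↦ e^{2⟨α+𝟏,x⟩}`. -/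
noncomputable def expMonomial {n : ℕ} (α : Fin n → ℕ) (x : Fin n → ℝ) : ℝ :=
  exp (2 * ∑ j, ((α j : ℝ) + 1) * x j)

theorem expMonomial_pos {n : ℕ} (α : Fin n → ℕ) (x : Fin n → ℝ) : 0 < expMonomial α x :=
  exp_pos _

theorem continuous_expMonomial {n : ℕ} (α : Fin n → ℕ) : Continuous (expMonomial α) := by
  unfold expMonomial
  fun_prop

/-- The density `1 + ∑_{|α| ≤ m} e^{2⟨α+𝟏,x⟩}`. -/
noncomputable def weight (n m : ℕ) (x : Fin n → ℝ) : ℝ :=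
  1 + ∑ α ∈ boundedExponents n m, expMonomial α x

theorem continuous_weight (n m : ℕ) : Continuous (weight n m) :=
  continuous_const.add (continuous_finsetSum _ fun α _ => continuous_expMonomial α)

theorem exists_isOpen_withDensity_weight_le_lintegral_eq_top {n : ℕ} (hn : 0 < n) (m : ℕ)
    {ε : ENNReal} (hε : ε ≠ 0) :
    ∃ S : Set (Fin n → ℝ), IsOpen S ∧
      volume.withDensity (fun x => ENNReal.ofReal (weight n m x)) S ≤ ε ∧
      ∀ α : Fin n → ℕ, m + 1 ≤ ∑ j, α j →
        ∫⁻ x in S, ENNReal.ofReal (expMonomial α x) = ⊤ := by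
  have hn' : (0 : ℝ) < n := by exact_mod_cast hn
  set ν := volume.withDensity (fun x => ENNReal.ofReal (weight n m x)) with hν
  set p : ℝ := 2 * (m + n) + 1 with hp
  let r : ℕ → ℝ := fun k => exp (-(p * k) / n)
  have hr0 : ∀ k, 0 < r k := fun k => exp_pos _
  have hr1 : ∀ k, r k ≤ 1 := fun k => by
    apply exp_le_one_iff.2
    apply div_nonpos_of_nonpos_of_nonneg _ hn'.le
    have : 0 ≤ p * k := by positivity
    linarith
  let B : ℕ → Set (Fin n → ℝ) := fun k => Set.pi Set.univ fun _ => Set.Ioo (k : ℝ) (k + r k)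
  have hBo : ∀ k, IsOpen (B k) := fun k => isOpen_set_pi Set.finite_univ fun _ _ => isOpen_Ioo
  have hvol : ∀ k, volume (B k) = ENNReal.ofReal (exp (-(p * k))) := fun k => by
    simp only [B, Real.volume_pi_Ioo, add_sub_cancel_left, Finset.prod_const, Finset.card_univ,
      Fintype.card_fin]
    rw [← ENNReal.ofReal_pow (hr0 k).le, ← exp_nat_mul]
    congr 2
    field_simp
  have hup : ∀ k, ∀ x ∈ B k, weight n m x ≤
      (1 + (boundedExponents n m).card * exp (2 * (m + n))) * exp (2 * (m + n) * k) := by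
    intro k x hx
    have h1 : (1 : ℝ) ≤ exp (2 * (m + n) * k) := one_le_exp (by positivity)
    have h2 : ∀ α ∈ boundedExponents n m,
        expMonomial α x ≤ exp (2 * (m + n)) * exp (2 * (m + n) * k) := by
      intro α hα
      rw [← exp_add, expMonomial]
      apply exp_le_exp.2
      have h3 : ∑ j, ((α j : ℝ) + 1) * x j ≤ ∑ j, ((α j : ℝ) + 1) * (k + 1) := by
        gcongr with j
        have := (hx j (Set.mem_univ j)).2
        linarith [hr1 k]
      have h4 : ∑ j, ((α j : ℝ) + 1) ≤ m + n := by
        rw [Finset.sum_add_distrib]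
        have := mem_boundedExponents.1 hα
        have : (∑ j, (α j : ℝ)) ≤ m := by exact_mod_cast this
        simpa using this
      rw [← Finset.sum_mul] at h3
      nlinarith [mul_le_mul_of_nonneg_right h4 (by positivity : (0 : ℝ) ≤ k + 1)]
    have h5 := Finset.sum_le_card_nsmul _ _ _ h2
    rw [nsmul_eq_mul] at h5
    unfold weight
    linarith
  have hsum : ∑' k, ν (B k) ≠ ⊤ := by
    set C : ℝ := 1 + (boundedExponents n m).card * exp (2 * (m + n)) with hC
    have hC0 : 0 ≤ C := by positivity
    have h1 : ∀ k, ν (B k) ≤ ENNReal.ofReal (C * exp (-1) ^ k) := by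
      intro k
      rw [hν, withDensity_apply _ (hBo k).measurableSet]
      refine (setLIntegral_mono measurable_const fun x hx =>
        ENNReal.ofReal_le_ofReal (hup k x hx)).trans ?_
      rw [setLIntegral_const, hvol, ← ENNReal.ofReal_mul (by positivity)]
      apply ENNReal.ofReal_le_ofReal
      rw [mul_assoc, ← exp_add, ← exp_nat_mul]
      apply le_of_eq
      congr 2
      rw [hp]
      ring
    refine ne_top_of_le_ne_top ?_ (ENNReal.tsum_le_tsum h1)
    have h2 : Summable fun k : ℕ => C * exp (-1) ^ k :=
      (summable_geometric_of_lt_one (exp_pos _).le (exp_lt_one_iff.2 (by norm_num))).mul_left C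
    exact h2.tsum_ofReal_ne_top
  obtain ⟨K, hK⟩ := ((ENNReal.tendsto_sum_nat_add _ hsum).eventually
    (ge_mem_nhds (pos_iff_ne_zero.2 hε))).exists
  refine ⟨⋃ k, B (k + K), isOpen_iUnion fun k => hBo _, (measure_iUnion_le _).trans hK, ?_⟩
  intro α hα
  have hlow : ∀ k : ℕ, ENNReal.ofReal (exp ((k + K : ℕ) : ℝ)) ≤
      ∫⁻ x in ⋃ k, B (k + K), ENNReal.ofReal (expMonomial α x) := by
    intro k
    refine le_trans ?_ (lintegral_mono_set (Set.subset_iUnion (fun k => B (k + K)) k))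
    set q := k + K
    have h1 : ∀ x ∈ B q, ENNReal.ofReal (exp (2 * (m + 1 + n) * q)) ≤
        ENNReal.ofReal (expMonomial α x) := by
      intro x hx
      apply ENNReal.ofReal_le_ofReal
      apply exp_le_exp.2
      have h3 : ∑ j, ((α j : ℝ) + 1) * q ≤ ∑ j, ((α j : ℝ) + 1) * x j := by
        gcongr with j
        exact (hx j (Set.mem_univ j)).1.le
      have h4 : (m + 1 + n : ℝ) ≤ ∑ j, ((α j : ℝ) + 1) := by
        rw [Finset.sum_add_distrib]
        have : (m + 1 : ℝ) ≤ (∑ j, (α j : ℝ)) := by exact_mod_cast hα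
        simpa using this
      rw [← Finset.sum_mul] at h3
      nlinarith [mul_le_mul_of_nonneg_right h4 (by positivity : (0 : ℝ) ≤ q)]
    refine le_trans ?_ (setLIntegral_mono' (hBo q).measurableSet h1)
    rw [setLIntegral_const, hvol, ← ENNReal.ofReal_mul (exp_pos _).le, ← exp_add]
    apply ENNReal.ofReal_le_ofReal
    apply exp_le_exp.2
    rw [hp]
    have : (0 : ℝ) ≤ q := by positivity
    nlinarith
  have htop : Filter.Tendsto (fun k : ℕ => ENNReal.ofReal (exp ((k + K : ℕ) : ℝ)))
      Filter.atTop (nhds ⊤) :=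
    ENNReal.tendsto_ofReal_atTop.comp (tendsto_exp_atTop.comp
      (tendsto_natCast_atTop_atTop.comp (Filter.tendsto_add_atTop_nat K)))
  exact top_le_iff.1 (le_of_tendsto' htop hlow)

theorem exists_isOpen_dense_isPreconnected_measure_le {n : ℕ} (hn : 2 ≤ n)
    (ν : Measure (Fin n → ℝ)) [IsLocallyFiniteMeasure ν] (hν : ν ≪ volume)
    {ε : ENNReal} (hε : ε ≠ 0) :
    ∃ D : Set (Fin n → ℝ), IsOpen D ∧ Dense D ∧ IsPreconnected D ∧ ν D ≤ ε := by
  obtain ⟨e, he, hsum⟩ := ENNReal.exists_pos_sum_of_countable' hε ℕ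
  have key : ∀ q : Fin n → ℝ, ∀ η : ENNReal, 0 < η →
      ∃ V : Set (Fin n → ℝ), IsOpen V ∧ IsPreconnected V ∧ 0 ∈ V ∧ q ∈ V ∧ ν V ≤ η := by
    intro q η hη
    have hnull : ν (segment ℝ 0 q) = 0 := by
      apply hν
      refine measure_mono_null (t := (Submodule.span ℝ {q} : Set (Fin n → ℝ))) ?_ ?_
      · rw [segment_eq_image]
        rintro _ ⟨t, -, rfl⟩
        simpa using Submodule.smul_mem _ t (Submodule.mem_span_singleton_self q)
      · apply Measure.addHaar_submodule
        intro h
        have h1 := finrank_span_le_card (R := ℝ) ({q} : Set (Fin n → ℝ))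
        rw [h, finrank_top, Module.finrank_fin_fun, Set.toFinset_singleton,
          Finset.card_singleton] at h1
        omega
    obtain ⟨O, hO, hOo, hOη⟩ := Set.exists_isOpen_lt_of_lt (segment ℝ 0 q) η (hnull ▸ hη)
    have hcpt : IsCompact (segment ℝ 0 q) := by
      rw [segment_eq_image]
      exact isCompact_Icc.image (by fun_prop)
    obtain ⟨δ, hδ, hsub⟩ := hcpt.exists_thickening_subset_open hOo hO
    exact ⟨Metric.thickening δ (segment ℝ 0 q), Metric.isOpen_thickening,
      ((convex_segment 0 q).thickening δ).isPreconnected,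
      Metric.self_subset_thickening hδ _ (left_mem_segment ℝ 0 q),
      Metric.self_subset_thickening hδ _ (right_mem_segment ℝ 0 q),
      (measure_mono hsub).trans hOη.le⟩
  choose V hVo hVc hV0 hVq hVm using
    fun k : ℕ => key (TopologicalSpace.denseSeq (Fin n → ℝ) k) (e k) (he k)
  refine ⟨⋃ k, V k, isOpen_iUnion hVo, ?_, ?_, ?_⟩
  · refine (TopologicalSpace.denseRange_denseSeq (Fin n → ℝ)).mono ?_
    rintro _ ⟨k, rfl⟩
    exact Set.mem_iUnion.2 ⟨k, hVq k⟩
  · exact isPreconnected_iUnion ⟨0, Set.mem_iInter.2 hV0⟩ hVc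
  · exact (measure_iUnion_le V).trans ((ENNReal.tsum_le_tsum hVm).trans hsum.le)

theorem norm_setIntegral_ball_sub_le {X F : Type*} [PseudoMetricSpace X] [MeasurableSpace X]
    [OpensMeasurableSpace X] [NormedAddCommGroup F] [NormedSpace ℝ F] [CompleteSpace F]
    (ρ : Measure X) (v : X → F)
    (x : X) {R η : ℝ} (hfin : ρ (Metric.ball x R) ≠ ⊤) (hint : IntegrableOn v (Metric.ball x R) ρ)
    (hη : ∀ y ∈ Metric.ball x R, ‖v y - v x‖ ≤ η) {r s : ℝ} (hr : r ≤ R) (hs : s ≤ R) :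
    ‖∫ y in Metric.ball x r, v y ∂ρ - ∫ y in Metric.ball x s, v y ∂ρ -
      (ρ.real (Metric.ball x r) - ρ.real (Metric.ball x s)) • v x‖ ≤
      η * |ρ.real (Metric.ball x r) - ρ.real (Metric.ball x s)| := by
  wlog h : s ≤ r generalizing r s
  · have := this hs hr (le_of_not_ge h)
    rw [abs_sub_comm, ← norm_neg]
    refine le_of_eq_of_le (congrArg norm ?_) this
    module
  have hsub : Metric.ball x s ⊆ Metric.ball x r := Metric.ball_subset_ball h
  have hrR : Metric.ball x r ⊆ Metric.ball x R := Metric.ball_subset_ball hr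
  have hfr : ρ (Metric.ball x r) ≠ ⊤ := measure_ne_top_of_subset hrR hfin
  have hdR : Metric.ball x r \ Metric.ball x s ⊆ Metric.ball x R := Set.sdiff_subset.trans hrR
  have hfd : ρ (Metric.ball x r \ Metric.ball x s) ≠ ⊤ := measure_ne_top_of_subset hdR hfin
  have hmeas : ρ.real (Metric.ball x r) - ρ.real (Metric.ball x s) =
      ρ.real (Metric.ball x r \ Metric.ball x s) :=
    (measureReal_sdiff hsub measurableSet_ball hfr).symm
  rw [hmeas, abs_of_nonneg measureReal_nonneg,
    ← setIntegral_sdiff measurableSet_ball (hint.mono_set hrR) hsub, ← setIntegral_const,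
    ← integral_sub (hint.mono_set hdR) (integrableOn_const hfd)]
  exact norm_setIntegral_le_of_norm_le_const hfd.lt_top fun y hy => hη y (hdR hy)

theorem volume_real_pi_ball {n : ℕ} (hn : n ≠ 0) (x : Fin n → ℝ) {r : ℝ} (hr : 0 ≤ r) :
    volume.real (Metric.ball x r) = (2 * r) ^ n := by
  rcases hr.eq_or_lt with rfl | hr
  · simp [hn]
  · rw [measureReal_def, Real.volume_pi_ball x hr, Fintype.card_fin,
      ENNReal.toReal_ofReal (by positivity)]

theorem exists_measureReal_restrict_ball_eq {n : ℕ} (hn : n ≠ 0) (E : Set (Fin n → ℝ))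
    (x : Fin n → ℝ) {R a : ℝ} (hR : 0 ≤ R) (ha : 0 ≤ a)
    (haR : a ≤ (volume.restrict E).real (Metric.ball x R)) :
    ∃ r ∈ Set.Icc 0 R, (volume.restrict E).real (Metric.ball x r) = a := by
  set ρ := volume.restrict E
  have key : ∀ r s : ℝ, 0 ≤ s → s ≤ r →
      ρ.real (Metric.ball x r) - ρ.real (Metric.ball x s) ≤ (2 * r) ^ n - (2 * s) ^ n := by
    intro r s hs hsr
    have hsub : Metric.ball x s ⊆ Metric.ball x r := Metric.ball_subset_ball hsr
    rw [← volume_real_pi_ball hn x hs, ← volume_real_pi_ball hn x (hs.trans hsr),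
      ← measureReal_sdiff hsub measurableSet_ball, ← measureReal_sdiff hsub measurableSet_ball]
    exact ENNReal.toReal_mono (measure_ne_top_of_subset Set.sdiff_subset measure_ball_lt_top.ne)
      (Measure.restrict_apply_le _ _)
  have hcont : ContinuousOn (fun r => ρ.real (Metric.ball x r)) (Set.Icc 0 R) := by
    have hg : ContinuousOn (fun r : ℝ => (2 * r) ^ n) (Set.Icc 0 R) := by fun_prop
    rw [Metric.continuousOn_iff] at hg ⊢
    intro r hr ε hε
    obtain ⟨δ, hδ, h⟩ := hg r hr ε hε
    refine ⟨δ, hδ, fun s hs hsr => lt_of_le_of_lt ?_ (h s hs hsr)⟩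
    have mono : ∀ u v : ℝ, u ≤ v → ρ.real (Metric.ball x u) ≤ ρ.real (Metric.ball x v) :=
      fun u v huv => measureReal_mono (Metric.ball_subset_ball huv) measure_ball_lt_top.ne
    rw [Real.dist_eq, Real.dist_eq]
    rcases le_total r s with hrs | hrs
    · rw [abs_of_nonneg (sub_nonneg.2 (mono _ _ hrs))]
      exact (key s r hr.1 hrs).trans (le_abs_self _)
    · rw [abs_sub_comm, abs_of_nonneg (sub_nonneg.2 (mono _ _ hrs)), abs_sub_comm]
      exact (key r s hs.1 hrs).trans (le_abs_self _)
  obtain ⟨r, hr, h⟩ := intermediate_value_Icc hR hcont (show a ∈ _ from ⟨by simpa using ha, haR⟩)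
  exact ⟨r, hr, h⟩

theorem exists_radius {X F : Type*} [MetricSpace X] [NormedAddCommGroup F]
    {v : X → F} (hv : Continuous v) (T : Finset X) {η : ℝ} (hη : 0 < η) :
    ∃ R > 0, (∀ x ∈ T, ∀ y ∈ Metric.ball x R, ‖v y - v x‖ ≤ η) ∧
      ∀ x ∈ T, ∀ y ∈ T, x ≠ y → Disjoint (Metric.ball x R) (Metric.ball y R) := by
  have h1 : ∀ᶠ R in nhdsWithin (0 : ℝ) (Set.Ioi 0),
      ∀ x ∈ T, ∀ y ∈ Metric.ball x R, ‖v y - v x‖ ≤ η := by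
    rw [Filter.eventually_all_finset]
    intro x _
    obtain ⟨δ, hδ, h⟩ := Metric.continuous_iff.1 hv x η hη
    filter_upwards [Ioo_mem_nhdsGT hδ] with R hR y hy
    rw [← dist_eq_norm]
    exact (h y ((Metric.mem_ball.1 hy).trans hR.2)).le
  have h2 : ∀ᶠ R in nhdsWithin (0 : ℝ) (Set.Ioi 0),
      ∀ x ∈ T, ∀ y ∈ T, x ≠ y → Disjoint (Metric.ball x R) (Metric.ball y R) := by
    simp_rw [Filter.eventually_all_finset]
    intro x _ y _
    by_cases hxy : x = y
    · simp [hxy]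
    · have : 0 < dist x y / 2 := half_pos (dist_pos.2 hxy)
      filter_upwards [Ioo_mem_nhdsGT this] with R hR _
      exact Metric.ball_disjoint_ball (by linarith [hR.2])
  obtain ⟨R, ⟨h1, h2⟩, hR⟩ := ((h1.and h2).and self_mem_nhdsWithin).exists
  exact ⟨R, hR, h1, h2⟩

theorem exists_isOpen_setIntegral_diff_eq {n : ℕ} (hn : n ≠ 0) {A : Type*} [Fintype A]
    {v : (Fin n → ℝ) → A → ℝ} (hv : Continuous v) {T : Finset (Fin n → ℝ)}
    {b : (Fin n → ℝ) → ℝ} (hb : ∀ x ∈ T, 0 < b x)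
    (hT : Submodule.span ℝ (v '' T) = ⊤) :
    ∃ c₀ > 0, ∀ c : ℝ, 0 < c → c < c₀ → ∃ ε > 0, ∀ D : Set (Fin n → ℝ), MeasurableSet D →
      volume D ≤ ENNReal.ofReal ε → ∀ z : A → ℝ, ‖z‖ ≤ ε →
        ∃ U : Set (Fin n → ℝ), IsOpen U ∧ Bornology.IsBounded U ∧
          ∫ x in U \ D, v x = c • ∑ x ∈ T, b x • v x - z := by
  classical
  let L : (T → ℝ) →L[ℝ] (A → ℝ) :=
    LinearMap.toContinuousLinearMap (Fintype.linearCombination ℝ fun x : T => v x)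
  have hLapp : ∀ a : T → ℝ, L a = ∑ x, a x • v x := fun a => by
    simp [L, Fintype.linearCombination_apply]
  have hLs : (L : (T → ℝ) →ₗ[ℝ] (A → ℝ)).range = ⊤ := by
    have : Set.range (fun x : T => v x) = v '' T := by
      rw [Set.image_eq_range]
      rfl
    simp [L, Fintype.range_linearCombination, this, hT]
  let N := L.nonlinearRightInverseOfSurjective hLs
  have hK : 0 < (N.nnnorm : ℝ)⁻¹ :=
    inv_pos.2 (L.nonlinearRightInverseOfSurjective_nnnorm_pos hLs)
  obtain ⟨β, hβ, hβb⟩ : ∃ β > 0, ∀ x ∈ T, β ≤ b x := by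
    have : ∀ᶠ β in nhdsWithin (0 : ℝ) (Set.Ioi 0), ∀ x ∈ T, β ≤ b x := by
      rw [Filter.eventually_all_finset]
      intro x hx
      filter_upwards [Ioo_mem_nhdsGT (hb x hx)] with β h using h.2.le
    obtain ⟨β, h, hβ⟩ := (this.and self_mem_nhdsWithin).exists
    exact ⟨β, hβ, h⟩
  let b' : T → ℝ := fun x => b x
  set κinv := (N.nnnorm : ℝ)⁻¹
  have hδden : 0 < ‖b'‖ + β + 1 := by positivity
  obtain ⟨δ, hδ, hδe⟩ : ∃ δ > 0, δ * (‖b'‖ + β + 1) = κinv * β :=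
    ⟨κinv * β / (‖b'‖ + β + 1), by positivity, by field_simp⟩
  obtain ⟨η, hη, hηe⟩ : ∃ η > 0, η * (T.card + 1) = δ :=
    ⟨δ / (T.card + 1), by positivity, by field_simp⟩
  obtain ⟨R, hR, hRv, hRd⟩ := exists_radius hv T hη
  have hκ : 0 < (2 * R) ^ n := by positivity
  set κ := (2 * R) ^ n
  refine ⟨κ / (4 * (‖b'‖ + 1)), by positivity, fun c hc hcc => ?_⟩
  refine ⟨min (c * δ) (κ / 2), by positivity, fun D hD hDε z hz => ?_⟩
  have hDκ : volume D ≤ ENNReal.ofReal (κ / 2) :=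
    hDε.trans (ENNReal.ofReal_le_ofReal (min_le_right _ _))
  have hzδ : ‖z‖ ≤ c * δ := hz.trans (min_le_left _ _)
  set ρ := volume.restrict Dᶜ with hρ
  have hρball : ∀ x, κ / 2 ≤ ρ.real (Metric.ball x R) := by
    intro x
    have h1 : volume.real (Metric.ball x R) ≤ ρ.real (Metric.ball x R) + κ / 2 := by
      have h2 : volume (Metric.ball x R) ≤ ρ (Metric.ball x R) + volume D := by
        rw [hρ, Measure.restrict_apply measurableSet_ball]
        refine (measure_mono fun y hy => ?_).trans (measure_union_le _ _)
        by_cases hyD : y ∈ D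
        · exact Or.inr hyD
        · exact Or.inl ⟨hy, hyD⟩
      have h3 := ENNReal.toReal_mono (ENNReal.add_ne_top.2
        ⟨measure_ball_lt_top.ne, ENNReal.ofReal_ne_top⟩) (h2.trans (add_le_add le_rfl hDκ))
      rwa [ENNReal.toReal_add measure_ball_lt_top.ne ENNReal.ofReal_ne_top,
        ENNReal.toReal_ofReal (by positivity)] at h3
    rw [volume_real_pi_ball hn x hR.le] at h1
    linarith
  have hrad : ∀ (x : Fin n → ℝ) (a : ℝ), ∃ r, a ∈ Set.Icc 0 (κ / 2) →
      r ≤ R ∧ ρ.real (Metric.ball x r) = a := by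
    intro x a
    by_cases ha : a ∈ Set.Icc 0 (κ / 2)
    · obtain ⟨r, hr, h⟩ := exists_measureReal_restrict_ball_eq hn Dᶜ x hR.le ha.1
        (ha.2.trans (hρball x))
      exact ⟨r, fun _ => ⟨hr.2, h⟩⟩
    · exact ⟨0, fun h => absurd h ha⟩
  choose rad hrad using hrad
  have hint : ∀ x r, IntegrableOn v (Metric.ball x r) ρ := fun x r =>
    (hv.continuousOn.integrableOn_compact (isCompact_closedBall x r)).restrict.mono_set
      Metric.ball_subset_closedBall
  let F : (T → ℝ) → A → ℝ := fun a =>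
    ∑ x : T, ∫ y in Metric.ball (x : Fin n → ℝ) (rad x (a x)), v y ∂ρ
  let s : Set (T → ℝ) := Set.Icc 0 (fun _ => κ / 2)
  have happrox : ApproximatesLinearOn F L s ⟨δ, hδ.le⟩ := by
    intro a ha a' ha'
    have h1 : F a - F a' - L (a - a') = ∑ x : T,
        (∫ y in Metric.ball (x : Fin n → ℝ) (rad x (a x)), v y ∂ρ -
          ∫ y in Metric.ball (x : Fin n → ℝ) (rad x (a' x)), v y ∂ρ - (a x - a' x) • v x) := by
      rw [hLapp, Finset.sum_sub_distrib, Finset.sum_sub_distrib]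
      rfl
    rw [h1]
    refine (norm_sum_le _ _).trans ?_
    have h2 : ∀ x ∈ (Finset.univ : Finset T),
        ‖∫ y in Metric.ball (x : Fin n → ℝ) (rad x (a x)), v y ∂ρ -
          ∫ y in Metric.ball (x : Fin n → ℝ) (rad x (a' x)), v y ∂ρ - (a x - a' x) • v x‖ ≤
          η * ‖a - a'‖ := by
      intro x _
      obtain ⟨hr, hra⟩ := hrad x (a x) ⟨ha.1 x, ha.2 x⟩
      obtain ⟨hr', hra'⟩ := hrad x (a' x) ⟨ha'.1 x, ha'.2 x⟩
      have h3 := norm_setIntegral_ball_sub_le ρ v (x : Fin n → ℝ) measure_ball_lt_top.ne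
        (hint x R) (hRv x x.2) hr hr'
      rw [hra, hra'] at h3
      refine h3.trans ?_
      gcongr
      exact norm_le_pi_norm (a - a') x
    refine (Finset.sum_le_card_nsmul _ _ _ h2).trans ?_
    rw [nsmul_eq_mul, Finset.card_univ, Fintype.card_coe]
    change _ ≤ δ * ‖a - a'‖
    rw [← hηe]
    nlinarith [mul_nonneg hη.le (norm_nonneg (a - a'))]
  have hb'n : ∀ x, b' x ≤ ‖b'‖ := fun x => (le_abs_self _).trans (norm_le_pi_norm b' x)
  have hcκ : c * ‖b'‖ * 2 ≤ κ / 2 := by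
    rw [lt_div_iff₀ (by positivity)] at hcc
    nlinarith
  have hball : Metric.closedBall (c • b') (c * β) ⊆ s := by
    intro a ha
    rw [closedBall_pi _ (by positivity), Set.mem_univ_pi] at ha
    have : ∀ x : T, 0 ≤ a x ∧ a x ≤ κ / 2 := by
      intro x
      have h1 := ha x
      rw [Real.closedBall_eq_Icc, Set.mem_Icc] at h1
      have h2 : (c • b') x = c * b' x := rfl
      rw [h2] at h1
      have h3 : c * β ≤ c * b' x := mul_le_mul_of_nonneg_left (hβb x x.2) hc.le
      have h4 : c * b' x ≤ c * ‖b'‖ := mul_le_mul_of_nonneg_left (hb'n x) hc.le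
      constructor <;> linarith
    exact ⟨fun x => (this x).1, fun x => (this x).2⟩
  have hcb : c • b' ∈ s := hball (Metric.mem_closedBall_self (by positivity))
  have h0 : (0 : T → ℝ) ∈ s := ⟨le_rfl, fun _ => by positivity⟩
  have hF0 : F 0 = 0 := by
    refine Finset.sum_eq_zero fun x _ => ?_
    have h1 := (hrad x 0 ⟨le_rfl, by positivity⟩).2
    rw [measureReal_eq_zero_iff measure_ball_lt_top.ne] at h1
    exact setIntegral_measure_zero _ h1
  have hsurj := happrox.surjOn_closedBall_of_nonlinearRightInverse N (by positivity) hball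
  have hmem : c • L b' - z ∈ Metric.closedBall (F (c • b')) ((κinv - δ) * (c * β)) := by
    rw [mem_closedBall_iff_norm, ← norm_neg]
    have h1 := happrox (c • b') hcb 0 h0
    rw [hF0, sub_zero, sub_zero, map_smul, norm_smul, Real.norm_of_nonneg hc.le] at h1
    change _ ≤ δ * (c * ‖b'‖) at h1
    have h2 : -(c • L b' - z - F (c • b')) = (F (c • b') - c • L b') + z := by abel
    rw [h2]
    refine (norm_add_le _ _).trans ((add_le_add h1 hzδ).trans (le_of_eq ?_))
    linear_combination c * hδe
  obtain ⟨a, ha, haF⟩ := hsurj hmem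
  have has := hball ha
  have hradR : ∀ x : T, rad x (a x) ≤ R := fun x => (hrad x (a x) ⟨has.1 x, has.2 x⟩).1
  refine ⟨⋃ x : T, Metric.ball (x : Fin n → ℝ) (rad x (a x)),
    isOpen_iUnion fun x => Metric.isOpen_ball,
    Bornology.isBounded_iUnion.2 fun x => Metric.isBounded_ball, ?_⟩
  have h1 : volume.restrict ((⋃ x : T, Metric.ball (x : Fin n → ℝ) (rad x (a x))) \ D) =
      ρ.restrict (⋃ x : T, Metric.ball (x : Fin n → ℝ) (rad x (a x))) := by
    rw [hρ, Measure.restrict_restrict (MeasurableSet.iUnion fun x => measurableSet_ball)]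
    rfl
  rw [h1, integral_iUnion_fintype (fun x => measurableSet_ball) ?_ fun x => hint _ _]
  · change F a = _
    rw [haF, hLapp, ← Finset.sum_coe_sort T]
  · intro x y hxy
    exact (hRd x x.2 y y.2 fun h => hxy (Subtype.ext h)).mono
      (Metric.ball_subset_ball (hradR x)) (Metric.ball_subset_ball (hradR y))

open scoped Pointwise in
theorem exists_pos_combination_eq {X A : Type*} [Fintype A] (v : X → A → ℝ) (w : A → ℝ)
    (hw : ∀ f : (A → ℝ) →ₗ[ℝ] ℝ, (∀ x, f (v x) ≤ 0) → 0 ≤ f w → f = 0) :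
    ∃ (T : Finset X) (b : X → ℝ), (∀ x ∈ T, 0 < b x) ∧
      Submodule.span ℝ (v '' T) = ⊤ ∧ ∑ x ∈ T, b x • v x = w := by
  classical
  have hspan : Submodule.span ℝ (Set.range v) = ⊤ := by
    by_contra h
    obtain ⟨f, hf0, hf⟩ := Submodule.exists_dual_map_eq_bot_of_lt_top (lt_top_iff_ne_top.2 h)
      inferInstance
    have hfv : ∀ x, f (v x) = 0 := fun x => by
      have : f (v x) ∈ Submodule.map f (Submodule.span ℝ (Set.range v)) :=
        Submodule.mem_map_of_mem (Submodule.subset_span ⟨x, rfl⟩)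
      simpa [hf] using this
    rcases le_total 0 (f w) with h0 | h0
    · exact hf0 (hw f (fun x => (hfv x).le) h0)
    · exact hf0 (neg_eq_zero.1 (hw (-f) (fun x => by simp [hfv x]) (by simpa using h0)))
  obtain ⟨T₀, hT₀⟩ : ∃ T₀ : Finset X, Submodule.span ℝ (v '' T₀) = ⊤ := by
    obtain ⟨s, hs, hs'⟩ := (Submodule.fg_span_iff_fg_span_finset_subset (Set.range v)).1
      (hspan ▸ (inferInstance : Module.Finite ℝ (A → ℝ)).fg_top)
    obtain ⟨T₀, hT₀⟩ : ∃ T₀ : Finset X, T₀.image v = s := by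
      rw [← Set.image_univ] at hs
      obtain ⟨T₀, -, h⟩ := Finset.subset_set_image_iff.1 hs
      exact ⟨T₀, h⟩
    exact ⟨T₀, by rw [← Finset.coe_image, hT₀, ← hs', hspan]⟩
  let V : (X →₀ ℝ) →ₗ[ℝ] (A → ℝ) := Finsupp.linearCombination ℝ v
  let L : (T₀ → ℝ) →ₗ[ℝ] (A → ℝ) := Fintype.linearCombination ℝ fun x : T₀ => v x
  have hL : Function.Surjective L := by
    rw [← LinearMap.range_eq_top, Fintype.range_linearCombination, ← hT₀, Set.image_eq_range]
    rfl
  let K : Set (A → ℝ) := L '' {a | ∀ i, 0 < a i} + V '' {b | ∀ x, 0 ≤ b x}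
  have hKo : IsOpen K := by
    apply IsOpen.add_right
    have ho : IsOpen {a : T₀ → ℝ | ∀ i, 0 < a i} := by
      simp only [Set.ofPred_forall]
      exact isOpen_iInter_of_finite fun i => isOpen_lt continuous_const (continuous_apply i)
    exact (LinearMap.toContinuousLinearMap L).isOpenMap hL _ ho
  have hKc : Convex ℝ K := by
    apply Convex.add
    · apply Convex.linear_image
      intro a ha a' ha' s t hs ht hst i
      have h1 := ha i
      have h2 := ha' i
      rcases hs.eq_or_lt with rfl | hs
      · have : t = 1 := by linarith
        simp [this, h2]
      · have : 0 < s * a i + t * a' i := by positivity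
        simpa using this
    · apply Convex.linear_image
      intro b hb b' hb' s t hs ht _ x
      have : 0 ≤ s * b x + t * b' x :=
        add_nonneg (mul_nonneg hs (hb x)) (mul_nonneg ht (hb' x))
      simpa using this
  have hKs : ∀ k ∈ K, ∀ t : ℝ, 0 < t → t • k ∈ K := by
    rintro _ ⟨_, ⟨a, ha, rfl⟩, _, ⟨b, hb, rfl⟩, rfl⟩ t ht
    refine ⟨_, ⟨t • a, fun i => mul_pos ht (ha i), rfl⟩, _,
      ⟨t • b, fun x => mul_nonneg ht.le (hb x), rfl⟩, ?_⟩
    simp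
  have hKv : ∀ k ∈ K, ∀ x, k + v x ∈ K := by
    rintro _ ⟨_, ⟨a, ha, rfl⟩, _, ⟨b, hb, rfl⟩, rfl⟩ x
    refine ⟨_, ⟨a, ha, rfl⟩, _, ⟨b + Finsupp.single x 1, fun y => ?_, rfl⟩, ?_⟩
    · have : 0 ≤ Finsupp.single x (1 : ℝ) y := by
        rw [Finsupp.single_apply]
        split_ifs <;> norm_num
      exact add_nonneg (hb y) this
    · simp [V, add_assoc]
  have hne : L 1 ∈ K :=
    ⟨_, ⟨1, fun i => one_pos, rfl⟩, 0, ⟨0, fun x => le_rfl, map_zero _⟩, by simp⟩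
  have hwK : w ∈ K := by
    by_contra h
    obtain ⟨f, hf⟩ := geometric_hahn_banach_open_point hKc hKo h
    have hle : ∀ k ∈ K, f k ≤ 0 := by
      intro k hk
      by_contra! hpos
      obtain ⟨t, ht, htw⟩ : ∃ t > 0, f w ≤ t * f k :=
        ⟨(|f w| + 1) / f k, by positivity, by
          rw [div_mul_cancel₀ _ hpos.ne']
          linarith [le_abs_self (f w)]⟩
      have := hf _ (hKs k hk t ht)
      rw [map_smul, smul_eq_mul] at this
      linarith
    have hw0 : 0 ≤ f w := by
      by_contra! hneg
      obtain ⟨t, ht, htw⟩ : ∃ t > 0, f w ≤ t * f (L 1) :=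
        ⟨-f w / (|f (L 1)| + 1), div_pos (neg_pos.2 hneg) (by positivity), by
          rw [div_mul_eq_mul_div, le_div_iff₀ (by positivity)]
          nlinarith [neg_abs_le (f (L 1))]⟩
      have := hf _ (hKs _ hne t ht)
      rw [map_smul, smul_eq_mul] at this
      linarith
    have hv : ∀ x, f (v x) ≤ 0 := by
      intro x
      by_contra! hpos
      have hN : ∀ N : ℕ, L 1 + (N : ℝ) • v x ∈ K := by
        intro N
        induction N with
        | zero => simpa using hne
        | succ N ih =>
          have := hKv _ ih x
          rw [add_assoc] at this
          convert this using 2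
          push_cast
          module
      obtain ⟨N, hN'⟩ := exists_nat_gt (-f (L 1) / f (v x))
      have := hle _ (hN N)
      rw [map_add, map_smul, smul_eq_mul] at this
      rw [div_lt_iff₀ hpos] at hN'
      linarith
    have hf0 : (f : (A → ℝ) →ₗ[ℝ] ℝ) = 0 := hw _ hv hw0
    have h1 := hf _ hne
    have h2 : ∀ y, f y = 0 := fun y => LinearMap.congr_fun hf0 y
    rw [h2, h2] at h1
    exact lt_irrefl _ h1
  obtain ⟨_, ⟨a, ha, rfl⟩, _, ⟨b, hb, rfl⟩, hab⟩ := hwK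
  let a' : X →₀ ℝ := Finsupp.onFinset T₀ (fun x => if h : x ∈ T₀ then a ⟨x, h⟩ else 0)
    fun x hx => by
      by_contra h
      simp [h] at hx
  have ha'0 : ∀ x, 0 ≤ a' x := fun x => by
    by_cases h : x ∈ T₀
    · simpa [a', h] using (ha ⟨x, h⟩).le
    · simp [a', h]
  have hsupp : ∀ x, x ∈ (a' + b).support → 0 < (a' + b) x := fun x hx =>
    (add_nonneg (ha'0 x) (hb x)).lt_of_ne' (Finsupp.mem_support_iff.1 hx)
  have hT₀s : T₀ ⊆ (a' + b).support := fun x hx => by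
    have h1 : 0 < a' x := by simpa [a', hx] using ha ⟨x, hx⟩
    exact Finsupp.mem_support_iff.2 (add_pos_of_pos_of_nonneg h1 (hb x)).ne'
  refine ⟨(a' + b).support, a' + b, hsupp, ?_, ?_⟩
  · exact top_le_iff.1 (hT₀ ▸ Submodule.span_mono (Set.image_mono hT₀s))
  · have h1 : V a' = L a := by
      simp only [V, L, Finsupp.linearCombination_apply, Fintype.linearCombination_apply]
      rw [Finsupp.onFinset_sum _ (fun x => zero_smul ℝ (v x)), ← Finset.sum_coe_sort T₀]
      simp
    have h2 : V (a' + b) = ∑ x ∈ (a' + b).support, (a' + b) x • v x :=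
      Finsupp.linearCombination_apply _ _
    rw [map_add, h1] at h2
    exact h2.symm.trans hab

theorem integral_exp_neg_mul_pow (k : ℕ) :
    ∫ x in Set.Ioi (0 : ℝ), exp (-x) * x ^ k = k.factorial := by
  rw [← Gamma_nat_eq_factorial, Gamma_eq_integral (by positivity)]
  simp

theorem integrableOn_exp_neg_mul_pow (k : ℕ) :
    IntegrableOn (fun x : ℝ => exp (-x) * x ^ k) (Set.Ioi 0) := by
  simpa using GammaIntegral_convergent (s := k + 1) (by positivity)

/-- The exponent `(α, m - |α|)` of the homogenization of `t ^ α` to degree `m`. -/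
def homogenizedExponent {n : ℕ} (m : ℕ) (α : Fin n → ℕ) : Option (Fin n) → ℕ
  | none => m - ∑ j, α j
  | some j => α j

theorem homogenizedExponent_injective {n : ℕ} (m : ℕ) :
    Function.Injective (homogenizedExponent (n := n) m) := fun _ _ h =>
  funext fun j => congrFun h (some j)

theorem eq_zero_of_sum_expMonomial_nonpos {n m : ℕ} (g : boundedExponents n m → ℝ)
    (hg : ∀ x, ∑ α : boundedExponents n m, g α * expMonomial (α : Fin n → ℕ) x ≤ 0)
    (hg0 : 0 ≤ ∑ α : boundedExponents n m,
      g α * ((∏ j, (((α : Fin n → ℕ) j).factorial : ℝ)) *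
        ((m - ∑ j, (α : Fin n → ℕ) j).factorial : ℝ))) :
    g = 0 := by
  set O : Set (Option (Fin n) → ℝ) := Set.pi Set.univ fun _ => Set.Ioi 0 with hO
  have hOo : IsOpen O := isOpen_set_pi Set.finite_univ fun _ _ => isOpen_Ioi
  let P : (Option (Fin n) → ℝ) → ℝ := fun u =>
    ∑ α : boundedExponents n m, g α * ∏ i, u i ^ homogenizedExponent m (α : Fin n → ℕ) i
  have hPneg : ∀ u ∈ O, P u ≤ 0 := by
    intro u hu
    have hu' : ∀ i, 0 < u i := fun i => hu i (Set.mem_univ i)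
    have h0 := hu' none
    let x : Fin n → ℝ := fun j => log (u (some j) / u none) / 2
    have h1 : ∀ α : Fin n → ℕ, expMonomial α x = ∏ j, (u (some j) / u none) ^ (α j + 1) := by
      intro α
      rw [expMonomial, Finset.mul_sum, exp_sum]
      refine Finset.prod_congr rfl fun j _ => ?_
      have hpos : 0 < u (some j) / u none := div_pos (hu' _) h0
      have : 2 * (((α j : ℝ) + 1) * x j) = ((α j + 1 : ℕ) : ℝ) * log (u (some j) / u none) := by
        push_cast
        ring
      rw [this, exp_nat_mul, exp_log hpos]
    set q := ∏ j, (u (some j) / u none)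
    have hq : 0 < q := Finset.prod_pos fun j _ => div_pos (hu' _) h0
    have h2 : P u * q = u none ^ m *
        ∑ α : boundedExponents n m, g α * expMonomial (α : Fin n → ℕ) x := by
      rw [Finset.sum_mul, Finset.mul_sum]
      refine Finset.sum_congr rfl fun α _ => ?_
      have hα := mem_boundedExponents.1 α.2
      rw [h1, Fintype.prod_option]
      simp only [homogenizedExponent, pow_succ, Finset.prod_mul_distrib, div_pow,
        Finset.prod_div_distrib, Finset.prod_pow_eq_pow_sum]
      have h3 : u none ^ m = u none ^ (m - ∑ j, (α : Fin n → ℕ) j) *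
          u none ^ (∑ j, (α : Fin n → ℕ) j) := by
        rw [← pow_add, Nat.sub_add_cancel hα]
      rw [h3]
      have : u none ^ (∑ j, (α : Fin n → ℕ) j) ≠ 0 := (pow_pos h0 _).ne'
      simp only [q, Finset.prod_div_distrib]
      field_simp
    have h3 : P u * q ≤ 0 :=
      h2 ▸ mul_nonpos_of_nonneg_of_nonpos (pow_nonneg h0.le _) (hg x)
    exact nonpos_of_mul_nonpos_left h3 hq
  let γ : Measure ℝ := volume.restrict (Set.Ioi 0)
  let Q : (Option (Fin n) → ℝ) → ℝ := fun u => ∑ α : boundedExponents n m,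
    g α * ∏ i, (exp (-u i) * u i ^ homogenizedExponent m (α : Fin n → ℕ) i)
  have hQP : ∀ u, Q u = (∏ i, exp (-u i)) * P u := fun u => by
    simp only [Q, P, Finset.mul_sum, Finset.prod_mul_distrib]
    exact Finset.sum_congr rfl fun α _ => by ring
  have hπ : (volume : Measure (Option (Fin n) → ℝ)).restrict O = Measure.pi fun _ => γ :=
    Measure.restrict_pi_pi _ _
  have hterm : ∀ α : boundedExponents n m, Integrable (fun u : Option (Fin n) → ℝ =>
      g α * ∏ i, (exp (-u i) * u i ^ homogenizedExponent m (α : Fin n → ℕ) i))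
      (Measure.pi fun _ => γ) := fun α =>
    (Integrable.fintype_prod (f := fun i x =>
      exp (-x) * x ^ homogenizedExponent m (α : Fin n → ℕ) i)
      fun i => integrableOn_exp_neg_mul_pow _).const_mul _
  have hQint : Integrable Q (Measure.pi fun _ => γ) := integrable_finsetSum _ fun α _ => hterm α
  have hQI : ∫ u, Q u ∂(Measure.pi fun _ => γ) = ∑ α : boundedExponents n m,
      g α * ((∏ j, (((α : Fin n → ℕ) j).factorial : ℝ)) *
        ((m - ∑ j, (α : Fin n → ℕ) j).factorial : ℝ)) := by
    rw [integral_finsetSum _ fun α _ => hterm α]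
    refine Finset.sum_congr rfl fun α _ => ?_
    rw [integral_const_mul, integral_fintype_prod_eq_prod (μ := fun _ => γ)
      (fun i x => exp (-x) * x ^ homogenizedExponent m (α : Fin n → ℕ) i)]
    simp only [γ, integral_exp_neg_mul_pow]
    rw [Fintype.prod_option, mul_comm (∏ j, _)]
    rfl
  have hQcont : Continuous Q := by fun_prop
  have hQneg : ∀ u ∈ O, Q u ≤ 0 := fun u hu => by
    rw [hQP]
    exact mul_nonpos_of_nonneg_of_nonpos (Finset.prod_nonneg fun i _ => (exp_pos _).le)
      (hPneg u hu)
  rw [← hπ] at hQint hQI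
  have hae : ∀ᵐ u ∂volume.restrict O, 0 ≤ -Q u := by
    filter_upwards [ae_restrict_mem hOo.measurableSet] with u hu
    exact neg_nonneg.2 (hQneg u hu)
  have hQ0 : ∫ u in O, -Q u = 0 := by
    refine le_antisymm ?_ (integral_nonneg_of_ae hae)
    rw [integral_neg, hQI]
    exact neg_nonpos.2 hg0
  have hQae := (integral_eq_zero_iff_of_nonneg_ae hae hQint.neg).1 hQ0
  have hQz : Set.EqOn (fun u => -Q u) 0 O :=
    Measure.eqOn_open_of_ae_eq hQae hOo hQcont.neg.continuousOn continuousOn_const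
  have hP0 : ∀ u ∈ O, P u = 0 := fun u hu => by
    have h1 : -Q u = 0 := hQz hu
    rw [neg_eq_zero, hQP, mul_eq_zero] at h1
    exact h1.resolve_left (Finset.prod_pos fun i _ => exp_pos _).ne'
  let e : boundedExponents n m → (Option (Fin n) →₀ ℕ) := fun α =>
    Finsupp.equivFunOnFinite.symm (homogenizedExponent m (α : Fin n → ℕ))
  have he : Function.Injective e :=
    Finsupp.equivFunOnFinite.symm.injective.comp
      ((homogenizedExponent_injective m).comp Subtype.val_injective)
  let p : MvPolynomial (Option (Fin n)) ℝ := ∑ α, MvPolynomial.monomial (e α) (g α)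
  have hp : p = 0 := by
    refine MvPolynomial.funext_set (fun _ => Set.Ioi 0) (fun _ => Set.Ioi_infinite 0) ?_
    intro u hu
    rw [map_zero, ← hP0 u hu, map_sum]
    refine Finset.sum_congr rfl fun α _ => ?_
    rw [MvPolynomial.eval_monomial, Finsupp.prod_fintype _ _ fun i => pow_zero _]
    rfl
  funext α
  have := congrArg (MvPolynomial.coeff (e α)) hp
  simpa [p, MvPolynomial.coeff_sum, MvPolynomial.coeff_monomial, he.eq_iff] using this

theorem exists_pos_combination_expMonomial_eq (n m : ℕ) :
    ∃ (T : Finset (Fin n → ℝ)) (b : (Fin n → ℝ) → ℝ), (∀ x ∈ T, 0 < b x) ∧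
      Submodule.span ℝ
        ((fun x (α : boundedExponents n m) => expMonomial (α : Fin n → ℕ) x) '' T) = ⊤ ∧
      ∑ x ∈ T, b x • (fun α : boundedExponents n m => expMonomial (α : Fin n → ℕ) x) =
        fun α : boundedExponents n m => (∏ j, (((α : Fin n → ℕ) j).factorial : ℝ)) *
          ((m - ∑ j, (α : Fin n → ℕ) j).factorial : ℝ) := by
  classical
  refine exists_pos_combination_eq _ _ fun f hf hfw => ?_
  have hfs : ∀ y, f y = ∑ α, f (Pi.single α 1) * y α := fun y => by
    rw [LinearMap.pi_apply_eq_sum_univ f y]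
    refine Finset.sum_congr rfl fun α _ => ?_
    rw [smul_eq_mul, mul_comm]
    congr 2
    funext β
    simp [Pi.single_apply, eq_comm]
  have h := eq_zero_of_sum_expMonomial_nonpos (fun α => f (Pi.single α 1))
    (fun x => by rw [← hfs fun α => expMonomial (α : Fin n → ℕ) x]; exact hf x)
    (by rw [hfs] at hfw; exact hfw)
  refine LinearMap.ext fun y => ?_
  rw [hfs y]
  refine Fintype.sum_eq_zero _ fun α => ?_
  have h0 : f (Pi.single α 1) = 0 := congrFun h α
  rw [h0, zero_mul]

/-- For each pair of positive integers `(m,n)` with `n ≥ 2` there is a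
constant `c₀ ∈ (0,1)` (depending only on `m` and `n`) such that for every `0 < c < c₀`
there is a nonempty connected open set `D ⊆ ℝⁿ` with
(a) `∫_D e^{2⟨α+𝟏,x⟩} dx = c (2π)^{-n} α!(m−|α|)!/m!` for all `α ∈ ℕⁿ` with `|α| ≤ m`, and
(b) `∫_D e^{2⟨α+𝟏,x⟩} dx = +∞` for all `α ∈ ℕⁿ` with `|α| ≥ m+1`. -/
theorem stmt8 (m n : ℕ) (hm : 0 < m) (hn : 2 ≤ n) :
    ∃ c₀ : ℝ, 0 < c₀ ∧ c₀ < 1 ∧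
      ∀ c : ℝ, 0 < c → c < c₀ →
        ∃ D : Set (Fin n → ℝ), D.Nonempty ∧ IsOpen D ∧ IsConnected D ∧
          (∀ α : Fin n → ℕ, ∑ j, α j ≤ m →
            (∫⁻ x in D, ENNReal.ofReal (Real.exp (2 * ∑ j, ((α j : ℝ) + 1) * x j)))
              = ENNReal.ofReal (c * (1 / (2 * π) ^ n) *
                  ((∏ j, ((α j).factorial : ℝ)) * ((m - ∑ j, α j).factorial : ℝ)
                    / (m.factorial : ℝ)))) ∧
          (∀ α : Fin n → ℕ, m + 1 ≤ ∑ j, α j →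
            (∫⁻ x in D, ENNReal.ofReal (Real.exp (2 * ∑ j, ((α j : ℝ) + 1) * x j)))
              = ⊤) := by
  obtain ⟨T, b, hb, hT, hTw⟩ := exists_pos_combination_expMonomial_eq n m
  have hn0 : n ≠ 0 := by omega
  have hv : Continuous fun x (α : boundedExponents n m) => expMonomial (α : Fin n → ℕ) x :=
    continuous_pi fun α => continuous_expMonomial _
  obtain ⟨c₁, hc₁, H⟩ := exists_isOpen_setIntegral_diff_eq hn0 hv hb hT
  set M : ℝ := (2 * π) ^ n * m.factorial with hM
  have hM0 : 0 < M := by positivity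
  refine ⟨min (c₁ * M) (1 / 2), by positivity, (min_le_right _ _).trans_lt (by norm_num),
    fun c hc hcc => ?_⟩
  obtain ⟨ε, hε, Hε⟩ := H (c / M) (by positivity)
    ((div_lt_iff₀ hM0).2 (hcc.trans_le (min_le_left _ _)))
  set ν := volume.withDensity fun x => ENNReal.ofReal (weight n m x) with hν
  have hε2 : ENNReal.ofReal (ε / 2) ≠ 0 := by simpa using hε
  have : IsLocallyFiniteMeasure ν :=
    IsLocallyFiniteMeasure.withDensity_ofReal (continuous_weight n m)
  obtain ⟨D₁, hD₁o, hD₁d, hD₁c, hD₁ν⟩ := exists_isOpen_dense_isPreconnected_measure_le hn ν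
    (withDensity_absolutelyContinuous _ _) hε2
  obtain ⟨S, hSo, hSν, hStop⟩ :=
    exists_isOpen_withDensity_weight_le_lintegral_eq_top (by omega : 0 < n) m hε2
  set D₀ := D₁ ∪ S with hD₀
  have hD₀o : IsOpen D₀ := hD₁o.union hSo
  have hD₀ν : ν D₀ ≤ ENNReal.ofReal ε := by
    refine (measure_union_le _ _).trans ((add_le_add hD₁ν hSν).trans ?_)
    rw [← ENNReal.ofReal_add (by positivity) (by positivity), add_halves]
  have hle : ∀ h : (Fin n → ℝ) → ℝ, (∀ x, h x ≤ weight n m x) →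
      ∫⁻ x in D₀, ENNReal.ofReal (h x) ≤ ENNReal.ofReal ε := fun h hh => by
    rw [hν, withDensity_apply _ hD₀o.measurableSet] at hD₀ν
    exact (lintegral_mono fun x => ENNReal.ofReal_le_ofReal (hh x)).trans hD₀ν
  have hvol : volume D₀ ≤ ENNReal.ofReal ε := by
    have := hle (fun _ => 1) fun x =>
      le_add_of_nonneg_right (Finset.sum_nonneg fun α _ => (expMonomial_pos α x).le)
    simpa using this
  have hmom : ∀ α ∈ boundedExponents n m,
      ∫⁻ x in D₀, ENNReal.ofReal (expMonomial α x) ≤ ENNReal.ofReal ε := fun α hα =>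
    hle _ fun x => by
      have := Finset.single_le_sum (f := fun α => expMonomial α x)
        (fun α _ => (expMonomial_pos α x).le) hα
      unfold weight
      linarith
  have hofReal : ∀ (α : Fin n → ℕ) (s : Set (Fin n → ℝ)), IntegrableOn (expMonomial α) s →
      ∫⁻ x in s, ENNReal.ofReal (expMonomial α x) =
        ENNReal.ofReal (∫ x in s, expMonomial α x) := fun α s hs =>
    (ofReal_integral_eq_lintegral_ofReal hs
      (Filter.Eventually.of_forall fun x => (expMonomial_pos α x).le)).symm
  have hnn : ∀ (α : Fin n → ℕ) (s : Set (Fin n → ℝ)), 0 ≤ ∫ x in s, expMonomial α x :=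
    fun α s => integral_nonneg fun x => (expMonomial_pos α x).le
  have hint₀ : ∀ α ∈ boundedExponents n m, IntegrableOn (expMonomial α) D₀ := fun α hα =>
    (lintegral_ofReal_ne_top_iff_integrable
      (continuous_expMonomial α).aestronglyMeasurable
      (Filter.Eventually.of_forall fun x => (expMonomial_pos α x).le)).1
      (ne_top_of_le_ne_top ENNReal.ofReal_ne_top (hmom α hα))
  obtain ⟨U, hUo, hUb, hU⟩ := Hε D₀ hD₀o.measurableSet hvol
    (fun α => ∫ x in D₀, expMonomial (α : Fin n → ℕ) x) (by
      refine (pi_norm_le_iff_of_nonneg hε.le).2 fun α => ?_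
      rw [Real.norm_of_nonneg (hnn _ _), ← ENNReal.ofReal_le_ofReal_iff hε.le,
        ← hofReal _ _ (hint₀ α α.2)]
      exact hmom α α.2)
  have hintU : ∀ α : Fin n → ℕ, IntegrableOn (expMonomial α) (U \ D₀) := fun α =>
    ((continuous_expMonomial α).continuousOn.integrableOn_compact
      hUb.isCompact_closure).mono_set (Set.sdiff_subset.trans subset_closure)
  have hDD : D₀ ∪ U = D₀ ∪ (U \ D₀) := Set.union_sdiff_self.symm
  have hDo : IsOpen (D₀ ∪ U) := hD₀o.union hUo
  have hne : (D₀ ∪ U).Nonempty := hD₁d.nonempty.mono fun x hx => Or.inl (Or.inl hx)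
  refine ⟨D₀ ∪ U, hne, hDo, ⟨hne, ?_⟩, fun α hα => ?_, fun α hα => ?_⟩
  · exact hD₁c.subset_closure (fun x hx => Or.inl (Or.inl hx)) fun x _ => hD₁d x
  · change ∫⁻ x in D₀ ∪ U, ENNReal.ofReal (expMonomial α x) = _
    have hα' := mem_boundedExponents.2 hα
    have hUα : ∫ x in U \ D₀, expMonomial α x = c / M * ((∏ j, ((α j).factorial : ℝ)) *
        ((m - ∑ j, α j).factorial : ℝ)) - ∫ x in D₀, expMonomial α x := by
      rw [hTw] at hU
      have h1 := congrFun hU ⟨α, hα'⟩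
      rw [eval_integral fun β => hintU _] at h1
      exact h1
    rw [hDD, lintegral_union (hUo.measurableSet.diff hD₀o.measurableSet) Set.disjoint_sdiff_right,
      hofReal α _ (hint₀ α hα'), hofReal α _ (hintU α), ← ENNReal.ofReal_add (hnn _ _) (hnn _ _),
      hUα, hM]
    congr 1
    field_simp
    ring
  · change ∫⁻ x in D₀ ∪ U, ENNReal.ofReal (expMonomial α x) = _
    refine top_le_iff.1 ((hStop α hα).symm.le.trans (lintegral_mono_set fun x hx => ?_))
    exact Or.inl (Or.inr hx)
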